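/- Let a dynamically nontrivial (n,m,r) mass action network factor over a p-partition P, with admissible choices of h, W, Q̂, Ĝ and F_κ(α,μ) := (h(α)/κ)^Ĝ ∘ μ^Q̂ as in the context, and let Z be a matrix of conservation laws. For fixed κ ∈ ℝ^m_+ and K ∈ ℝ^{n−r} define H_{κ,K}(α,μ) := (h(α)^W − κ^W, Z F_κ(α,μ) − K) on Y × ℝ^{n−s_P}_+. Then: (i) F_κ restricts to an injective map from the zero set of H_{κ,K} in Y × ℝ^{n−s_P}_+ onto E_κ ∩ S_K; (ii) for (α,μ) ∈ A_κ × ℝ^{n−s_P}_+ with x := F_κ(α,μ) and K := Zx, the Jacobian J_{F_κ}(α,μ) maps ker J_{H_{κ,K}}(α,μ) isomorphically onto ker J_{g_κ}(x) ∩ im Γ; consequently x is degenerate as an equilibrium if and only if (α,μ) is a degenerate zero of H_{κ,K}. -/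

import Mathlib

open Matrix

noncomputable section

/-- Entrywise power of a vector by a real exponent matrix:
`(powVec M x) i = ∏ j, (x j) ^ (M i j)` (real powers). -/
def powVec {k l : ℕ} (M : Matrix (Fin k) (Fin l) ℝ) (x : Fin l → ℝ) : Fin k → ℝ :=
  fun i => ∏ j, x j ^ M i j

/-- Cast an integer matrix to a real matrix. -/
def mR {a b : ℕ} (M : Matrix (Fin a) (Fin b) ℤ) : Matrix (Fin a) (Fin b) ℝ :=
  M.map fun t => (t : ℝ)

/-- The (open) positive orthant. -/
def posOrth (k : ℕ) : Set (Fin k → ℝ) :=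
  {x | ∀ i, 0 < x i}

/-- The mass action vector field `g_κ(x) = Γ (κ ∘ x^A)`. -/
def massAction {n m : ℕ} (Γ : Matrix (Fin n) (Fin m) ℤ) (A : Matrix (Fin m) (Fin n) ℤ)
    (κ : Fin m → ℝ) (x : Fin n → ℝ) : Fin n → ℝ :=
  (mR Γ).mulVec (κ * powVec (mR A) x)

/-- The positive equilibrium set `E_κ`. -/
def Eset {n m : ℕ} (Γ : Matrix (Fin n) (Fin m) ℤ) (A : Matrix (Fin m) (Fin n) ℤ)
    (κ : Fin m → ℝ) : Set (Fin n → ℝ) :=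
  {x | (∀ i, 0 < x i) ∧ massAction Γ A κ x = 0}

/-- The Jacobian matrix `Γ D_{κ∘x^A} A D_{1/x}` of `g_κ` at `x`. -/
def jacMat {n m : ℕ} (Γ : Matrix (Fin n) (Fin m) ℤ) (A : Matrix (Fin m) (Fin n) ℤ)
    (κ : Fin m → ℝ) (x : Fin n → ℝ) : Matrix (Fin n) (Fin n) ℝ :=
  mR Γ * Matrix.diagonal (κ * powVec (mR A) x) * mR A * Matrix.diagonal (fun i => (x i)⁻¹)

/-- Nondegeneracy of an equilibrium: `ker J_{g_κ}(x) ∩ im Γ = {0}`. -/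
def nondegAt {n m : ℕ} (Γ : Matrix (Fin n) (Fin m) ℤ) (A : Matrix (Fin m) (Fin n) ℤ)
    (κ : Fin m → ℝ) (x : Fin n → ℝ) : Prop :=
  ∀ z : Fin n → ℝ, (jacMat Γ A κ x).mulVec z = 0 → (∃ v, (mR Γ).mulVec v = z) → z = 0

/-- Strong degeneracy of the network: every positive equilibrium has Jacobian of
rank less than `rank Γ`, for every choice of rate constants. -/
def stronglyDegenerate {n m : ℕ} (Γ : Matrix (Fin n) (Fin m) ℤ)
    (A : Matrix (Fin m) (Fin n) ℤ) : Prop :=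
  ∀ κ ∈ posOrth m, ∀ x ∈ Eset Γ A κ, (jacMat Γ A κ x).rank < (mR Γ).rank

/-- Dynamically nontrivial: the positive flux cone `ker Γ ∩ ℝ^m_+` is nonempty. -/
def dynNontrivial {n m : ℕ} (Γ : Matrix (Fin n) (Fin m) ℤ) : Prop :=
  ∃ v : Fin m → ℝ, (mR Γ).mulVec v = 0 ∧ ∀ j, 0 < v j

/-- `ker Γ` factors over the partition of `{1,…,m}` given by the fibres of `blk`. -/
def factorsOver {n m p : ℕ} (Γ : Matrix (Fin n) (Fin m) ℤ) (blk : Fin m → Fin p) : Prop :=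
  ∀ v : Fin m → ℝ, (mR Γ).mulVec v = 0 →
    ∀ i : Fin p, (mR Γ).mulVec (fun j => if blk j = i then v j else 0) = 0

/-- The matrix `[A | 1_P]`. -/
def srcMat {n m p : ℕ} (A : Matrix (Fin m) (Fin n) ℤ) (blk : Fin m → Fin p) :
    Matrix (Fin m) (Fin (n + p)) ℝ :=
  Matrix.of fun j => Fin.append (fun k => (A j k : ℝ)) (fun i => if blk j = i then 1 else 0)

/-- The first `n` rows of an `(n+p)×k` matrix. -/
def topRows (n p : ℕ) {k : ℕ} (M : Matrix (Fin (n + p)) (Fin k) ℝ) :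
    Matrix (Fin n) (Fin k) ℝ :=
  Matrix.of fun i j => M (Fin.castAdd p i) j

/-- The flux-cone parameterisation `(1_P λ) ∘ h(α)`. -/
def fluxParam {m p d : ℕ} (blk : Fin m → Fin p) (h : (Fin d → ℝ) → (Fin m → ℝ))
    (lam : Fin p → ℝ) (α : Fin d → ℝ) : Fin m → ℝ :=
  fun j => lam (blk j) * h α j

/-- Admissible cross-section parameterisation of the positive flux cone:
`Y` is an open bounded convex set (an open polytope), `h` is affine and injective,
depends blockwise on the coordinates of `Y`, and `(λ, α) ↦ (1_P λ) ∘ h(α)` is a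
bijection from `ℝ^p_+ × Y` onto the positive flux cone. -/
def admissibleH {n m p d : ℕ} (Γ : Matrix (Fin n) (Fin m) ℤ) (blk : Fin m → Fin p)
    (Y : Set (Fin d → ℝ)) (h : (Fin d → ℝ) → (Fin m → ℝ)) : Prop :=
  IsOpen Y ∧ Convex ℝ Y ∧ Bornology.IsBounded Y ∧ Y.Nonempty ∧
  (∃ (L : (Fin d → ℝ) →ₗ[ℝ] (Fin m → ℝ)) (c : Fin m → ℝ), ∀ α, h α = L α + c) ∧
  (∃ bY : Fin d → Fin p, ∀ (α α' : Fin d → ℝ) (j : Fin m),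
      (∀ t, bY t = blk j → α t = α' t) → h α j = h α' j) ∧
  (∀ (lam : Fin p → ℝ) (α : Fin d → ℝ), (∀ i, 0 < lam i) → α ∈ Y →
      (mR Γ).mulVec (fluxParam blk h lam α) = 0 ∧ ∀ j, 0 < fluxParam blk h lam α j) ∧
  (∀ v : Fin m → ℝ, (mR Γ).mulVec v = 0 → (∀ j, 0 < v j) →
      ∃ (lam : Fin p → ℝ) (α : Fin d → ℝ), (∀ i, 0 < lam i) ∧ α ∈ Y ∧
        v = fluxParam blk h lam α) ∧
  (∀ (lam lam' : Fin p → ℝ) (α α' : Fin d → ℝ), (∀ i, 0 < lam i) → (∀ i, 0 < lam' i) →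
      α ∈ Y → α' ∈ Y → fluxParam blk h lam α = fluxParam blk h lam' α' →
      lam = lam' ∧ α = α')

/-- The solvability variety `A_κ = {α ∈ Y : h(α)^W = κ^W}`. -/
def Aset {m d w : ℕ} (W : Matrix (Fin w) (Fin m) ℝ) (Y : Set (Fin d → ℝ))
    (h : (Fin d → ℝ) → (Fin m → ℝ)) (κ : Fin m → ℝ) : Set (Fin d → ℝ) :=
  {α ∈ Y | powVec W (h α) = powVec W κ}

/-- The rows of `W` form a basis of `ker [A|1_P]ᵀ`. -/
def isSolvabilityMatrix {n m p w : ℕ} (A : Matrix (Fin m) (Fin n) ℤ) (blk : Fin m → Fin p)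
    (W : Matrix (Fin w) (Fin m) ℝ) : Prop :=
  W * srcMat A blk = 0 ∧ W.rank = w ∧ w + (srcMat A blk).rank = m

/-- The columns of `Q` form a basis of `ker [A|1_P]`. -/
def isKernelMatrix {n m p q : ℕ} (A : Matrix (Fin m) (Fin n) ℤ) (blk : Fin m → Fin p)
    (Q : Matrix (Fin (n + p)) (Fin q) ℝ) : Prop :=
  srcMat A blk * Q = 0 ∧ Q.rank = q ∧ (srcMat A blk).rank + q = n + p

/-- `G` is a generalised inverse of `[A|1_P]`. -/
def isGenInv {n m p : ℕ} (A : Matrix (Fin m) (Fin n) ℤ) (blk : Fin m → Fin p)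
    (G : Matrix (Fin (n + p)) (Fin m) ℝ) : Prop :=
  srcMat A blk * G * srcMat A blk = srcMat A blk

/-- The parameterising map `F_κ(α,μ) = (h(α)/κ)^Ĝ ∘ μ^Q̂`. -/
def Fmap {n m p d q : ℕ} (G : Matrix (Fin (n + p)) (Fin m) ℝ)
    (Q : Matrix (Fin (n + p)) (Fin q) ℝ)
    (h : (Fin d → ℝ) → (Fin m → ℝ)) (κ : Fin m → ℝ) :
    (Fin d → ℝ) × (Fin q → ℝ) → (Fin n → ℝ) :=
  fun z => powVec (topRows n p G) (h z.1 / κ) * powVec (topRows n p Q) z.2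


section work
variable {k l : ℕ}

lemma powVec_pos (M : Matrix (Fin k) (Fin l) ℝ) {x : Fin l → ℝ} (hx : ∀ i, 0 < x i) (i : Fin k) :
    0 < powVec M x i :=
  Finset.prod_pos fun j _ => Real.rpow_pos_of_pos (hx j) _

lemma powVec_eq_exp (M : Matrix (Fin k) (Fin l) ℝ) {x : Fin l → ℝ} (hx : ∀ i, 0 < x i)
    (i : Fin k) : powVec M x i = Real.exp (∑ j, M i j * Real.log (x j)) := by
  unfold powVec
  rw [Real.exp_sum]
  refine Finset.prod_congr rfl fun j _ => ?_
  rw [Real.rpow_def_of_pos (hx j), mul_comm]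

lemma log_powVec (M : Matrix (Fin k) (Fin l) ℝ) {x : Fin l → ℝ} (hx : ∀ i, 0 < x i)
    (i : Fin k) : Real.log (powVec M x i) = M.mulVec (fun j => Real.log (x j)) i := by
  rw [powVec_eq_exp M hx, Real.log_exp]; rfl

lemma powVec_hasFDerivAt (M : Matrix (Fin k) (Fin l) ℝ) {x : Fin l → ℝ} (hx : ∀ i, 0 < x i) :
    HasFDerivAt (powVec M)
      (ContinuousLinearMap.pi fun i => powVec M x i •
        ∑ j, M i j • ((x j)⁻¹ • (ContinuousLinearMap.proj (R := ℝ) (φ := fun _ : Fin l => ℝ) j))) x := by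
  rw [hasFDerivAt_pi]
  intro i
  have h1 : HasFDerivAt (fun y : Fin l → ℝ => Real.exp (∑ j, M i j * Real.log (y j)))
      (Real.exp (∑ j, M i j * Real.log (x j)) • ∑ j, M i j • ((x j)⁻¹ • (ContinuousLinearMap.proj (R := ℝ) (φ := fun _ : Fin l => ℝ) j))) x := by
    apply HasFDerivAt.exp
    apply HasFDerivAt.fun_sum
    intro j _
    apply HasFDerivAt.const_mul
    exact HasFDerivAt.log (hasFDerivAt_apply j x) (hx j).ne'
  rw [powVec_eq_exp M hx]
  apply h1.congr_of_eventuallyEq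
  have : ∀ᶠ y in nhds x, ∀ j, 0 < y j := by
    rw [Filter.eventually_all]
    intro j
    exact (continuous_apply j).continuousAt.eventually (lt_mem_nhds (hx j))
  filter_upwards [this] with y hy
  exact powVec_eq_exp M hy i

/-- kernel equals range from a rank count -/
lemma exists_of_rank {a b e : ℕ} (P : Matrix (Fin a) (Fin b) ℝ) (R : Matrix (Fin b) (Fin e) ℝ)
    (h0 : P * R = 0) (hr : P.rank + R.rank = b) (v : Fin b → ℝ) (hv : P.mulVec v = 0) :
    ∃ y, R.mulVec y = v := by
  have hle : LinearMap.range R.mulVecLin ≤ LinearMap.ker P.mulVecLin := by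
    rintro _ ⟨y, rfl⟩
    simp [Matrix.mulVec_mulVec, h0]
  have hk := LinearMap.finrank_range_add_finrank_ker P.mulVecLin
  have heq := Submodule.eq_of_le_of_finrank_eq hle (by
    simp only [Matrix.rank] at hr
    simp at hk
    omega)
  have : v ∈ LinearMap.range R.mulVecLin := by rw [heq]; simpa using hv
  obtain ⟨y, hy⟩ := this
  exact ⟨y, hy⟩

lemma inj_of_rank {a b : ℕ} (P : Matrix (Fin a) (Fin b) ℝ) (hr : P.rank = b) (v : Fin b → ℝ)
    (hv : P.mulVec v = 0) : v = 0 := by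
  have hk := LinearMap.finrank_range_add_finrank_ker P.mulVecLin
  have : Module.finrank ℝ (LinearMap.ker P.mulVecLin) = 0 := by
    simp only [Matrix.rank] at hr
    simp at hk
    omega
  have h2 := Submodule.finrank_eq_zero.1 this
  have : v ∈ LinearMap.ker P.mulVecLin := by simpa using hv
  rw [h2] at this
  simpa using this

lemma srcMat_mulVec {n m p : ℕ} (A : Matrix (Fin m) (Fin n) ℤ) (blk : Fin m → Fin p)
    (v : Fin (n + p) → ℝ) (j : Fin m) :
    (srcMat A blk).mulVec v j =
      (mR A).mulVec (fun i => v (Fin.castAdd p i)) j + v (Fin.natAdd n (blk j)) := by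
  simp [Matrix.mulVec, dotProduct, Fin.sum_univ_add, srcMat, mR]

lemma topRows_mulVec {n p : ℕ} (M : Matrix (Fin (n + p)) (Fin k) ℝ) (v : Fin k → ℝ) :
    (topRows n p M).mulVec v = fun i => M.mulVec v (Fin.castAdd p i) := rfl

/-- blockwise scaling preserves the kernel -/
lemma scale_ker {n m p : ℕ} {Γ : Matrix (Fin n) (Fin m) ℤ} {blk : Fin m → Fin p}
    (hfac : factorsOver Γ blk) (v : Fin m → ℝ) (hv : (mR Γ).mulVec v = 0) (lam : Fin p → ℝ) :
    (mR Γ).mulVec (fun j => lam (blk j) * v j) = 0 := by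
  have : (fun j => lam (blk j) * v j) =
      ∑ i, lam i • (fun j => if blk j = i then v j else 0) := by
    ext j
    simp [Finset.sum_apply]
  rw [this, Matrix.mulVec_sum]
  apply Finset.sum_eq_zero
  intro i _
  rw [Matrix.mulVec_smul, hfac v hv i, smul_zero]

end work
section work2

lemma lift_eq {n m p w q : ℕ} {A : Matrix (Fin m) (Fin n) ℤ} {blk : Fin m → Fin p}
    {W : Matrix (Fin w) (Fin m) ℝ} (hW : isSolvabilityMatrix A blk W)
    {Q : Matrix (Fin (n + p)) (Fin q) ℝ} (hQ : isKernelMatrix A blk Q)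
    {G : Matrix (Fin (n + p)) (Fin m) ℝ} (hG : isGenInv A blk G)
    (u : Fin m → ℝ) (hu : W.mulVec u = 0) (b : Fin q → ℝ) :
    (srcMat A blk).mulVec (G.mulVec u + Q.mulVec b) = u := by
  obtain ⟨y, rfl⟩ := exists_of_rank W (srcMat A blk) hW.1 (by rw [hW.2.1]; exact hW.2.2) u hu
  rw [Matrix.mulVec_add, Matrix.mulVec_mulVec, Matrix.mulVec_mulVec, Matrix.mulVec_mulVec, hQ.1, hG]
  simp

lemma lift_exists {n m p w q : ℕ} {A : Matrix (Fin m) (Fin n) ℤ} {blk : Fin m → Fin p}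
    {W : Matrix (Fin w) (Fin m) ℝ} (hW : isSolvabilityMatrix A blk W)
    {Q : Matrix (Fin (n + p)) (Fin q) ℝ} (hQ : isKernelMatrix A blk Q)
    {G : Matrix (Fin (n + p)) (Fin m) ℝ} (hG : isGenInv A blk G)
    (u : Fin m → ℝ) (ξ : Fin (n + p) → ℝ) (hξ : (srcMat A blk).mulVec ξ = u) :
    W.mulVec u = 0 ∧ ∃ b : Fin q → ℝ, ξ = G.mulVec u + Q.mulVec b := by
  have h1 : W.mulVec u = 0 := by rw [← hξ, Matrix.mulVec_mulVec, hW.1, Matrix.zero_mulVec]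
  refine ⟨h1, ?_⟩
  have h2 := lift_eq hW hQ hG u h1 0
  obtain ⟨b, hb⟩ := exists_of_rank (srcMat A blk) Q hQ.1 (by rw [hQ.2.1]; exact hQ.2.2)
    (ξ - G.mulVec u) (by
      rw [Matrix.mulVec_sub, hξ]
      simp only [Matrix.mulVec_zero, add_zero] at h2
      rw [h2, sub_self])
  exact ⟨b, by rw [hb]; abel⟩

lemma top_inj {n m p q : ℕ} {A : Matrix (Fin m) (Fin n) ℤ} {blk : Fin m → Fin p}
    (hblk : Function.Surjective blk)
    {Q : Matrix (Fin (n + p)) (Fin q) ℝ} (hQ : isKernelMatrix A blk Q)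
    (b : Fin q → ℝ) (hb : ∀ i : Fin n, Q.mulVec b (Fin.castAdd p i) = 0) : b = 0 := by
  apply inj_of_rank Q hQ.2.1
  have h1 : (srcMat A blk).mulVec (Q.mulVec b) = 0 := by
    rw [Matrix.mulVec_mulVec, hQ.1, Matrix.zero_mulVec]
  ext i
  refine Fin.addCases (fun i => ?_) (fun i => ?_) i
  · exact hb i
  · obtain ⟨j, rfl⟩ := hblk i
    have h2 := congrFun h1 j
    rw [srcMat_mulVec] at h2
    have h3 : (fun i => Q.mulVec b (Fin.castAdd p i)) = (0 : Fin n → ℝ) := funext hb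
    rw [h3] at h2
    simpa using h2

lemma Fmap_pos {n m p d q : ℕ} (G : Matrix (Fin (n + p)) (Fin m) ℝ)
    (Q : Matrix (Fin (n + p)) (Fin q) ℝ) (h : (Fin d → ℝ) → (Fin m → ℝ)) {κ : Fin m → ℝ}
    (hκ : ∀ j, 0 < κ j) {α : Fin d → ℝ} {μ : Fin q → ℝ} (hα : ∀ j, 0 < h α j)
    (hμ : ∀ j, 0 < μ j) (i : Fin n) : 0 < Fmap G Q h κ (α, μ) i :=
  mul_pos (powVec_pos _ (fun j => div_pos (hα j) (hκ j)) i) (powVec_pos _ hμ i)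

lemma log_Fmap {n m p d q : ℕ} (G : Matrix (Fin (n + p)) (Fin m) ℝ)
    (Q : Matrix (Fin (n + p)) (Fin q) ℝ) (h : (Fin d → ℝ) → (Fin m → ℝ)) {κ : Fin m → ℝ}
    (hκ : ∀ j, 0 < κ j) {α : Fin d → ℝ} {μ : Fin q → ℝ} (hα : ∀ j, 0 < h α j)
    (hμ : ∀ j, 0 < μ j) (i : Fin n) : Real.log (Fmap G Q h κ (α, μ) i) =
      (G.mulVec (fun j => Real.log (h α j / κ j)) + Q.mulVec (fun j => Real.log (μ j)))
        (Fin.castAdd p i) := by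
  have hα' : ∀ j, 0 < (h α / κ) j := fun j => div_pos (hα j) (hκ j)
  show Real.log (powVec (topRows n p G) (h α / κ) i * powVec (topRows n p Q) μ i) = _
  rw [Real.log_mul (powVec_pos _ hα' i).ne' (powVec_pos _ hμ i).ne', log_powVec _ hα',
    log_powVec _ hμ]
  rfl

lemma powVec_W_iff {m w : ℕ} (W : Matrix (Fin w) (Fin m) ℝ) {y κ : Fin m → ℝ}
    (hκ : ∀ j, 0 < κ j) (hy : ∀ j, 0 < y j) :
    powVec W y = powVec W κ ↔ W.mulVec (fun j => Real.log (y j / κ j)) = 0 := by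
  have h1 : (fun j => Real.log (y j / κ j)) = (fun j => Real.log (y j)) - fun j => Real.log (κ j) := by
    ext j
    simp [Real.log_div (hy j).ne' (hκ j).ne']
  rw [h1, Matrix.mulVec_sub, sub_eq_zero]
  constructor
  · intro h
    ext i
    rw [← log_powVec W hy, ← log_powVec W hκ, h]
  · intro h
    ext i
    apply Real.log_injOn_pos (powVec_pos W hy i) (powVec_pos W hκ i)
    rw [log_powVec W hy, log_powVec W hκ, h]

lemma flux_iff {n m p d : ℕ} {A : Matrix (Fin m) (Fin n) ℤ} {blk : Fin m → Fin p}
    {h : (Fin d → ℝ) → (Fin m → ℝ)} {κ : Fin m → ℝ} (hκ : ∀ j, 0 < κ j)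
    {α : Fin d → ℝ} (hα : ∀ j, 0 < h α j) {x : Fin n → ℝ} (hx : ∀ i, 0 < x i)
    (ξ : Fin (n + p) → ℝ) (hξ : ∀ i, ξ (Fin.castAdd p i) = Real.log (x i)) :
    κ * powVec (mR A) x = fluxParam blk h (fun i => Real.exp (- ξ (Fin.natAdd n i))) α ↔
    (srcMat A blk).mulVec ξ = fun j => Real.log (h α j / κ j) := by
  rw [funext_iff, funext_iff]
  refine forall_congr' fun j => ?_
  rw [srcMat_mulVec, Real.log_div (hα j).ne' (hκ j).ne']
  have h1 : (fun i => ξ (Fin.castAdd p i)) = fun i => Real.log (x i) := funext hξ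
  rw [h1, ← log_powVec _ hx]
  have hp := powVec_pos (mR A) hx j
  have hpf : 0 < fluxParam blk h (fun i => Real.exp (-ξ (Fin.natAdd n i))) α j :=
    mul_pos (Real.exp_pos _) (hα j)
  rw [← Real.log_injOn_pos.eq_iff (x := (κ * powVec (mR A) x) j)
    (mul_pos (hκ j) hp) hpf]
  simp only [fluxParam, Pi.mul_apply]
  rw [Real.log_mul (hκ j).ne' hp.ne', Real.log_mul (Real.exp_pos _).ne' (hα j).ne', Real.log_exp]
  constructor <;> intro h <;> linarith

lemma admissible_pos {n m p d : ℕ} {Γ : Matrix (Fin n) (Fin m) ℤ} {blk : Fin m → Fin p}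
    {Y : Set (Fin d → ℝ)} {h : (Fin d → ℝ) → (Fin m → ℝ)} (hadm : admissibleH Γ blk Y h)
    {α : Fin d → ℝ} (hα : α ∈ Y) : (mR Γ).mulVec (h α) = 0 ∧ ∀ j, 0 < h α j := by
  obtain ⟨-, -, -, -, -, -, h7, -, -⟩ := hadm
  have := h7 1 α (by simp) hα
  have e : fluxParam blk h 1 α = h α := by ext j; simp [fluxParam]
  rwa [e] at this

lemma part_one {n m p d w q c : ℕ}
    {Γ : Matrix (Fin n) (Fin m) ℤ} {A : Matrix (Fin m) (Fin n) ℤ}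
    {blk : Fin m → Fin p} (hblk : Function.Surjective blk)
    {Y : Set (Fin d → ℝ)} {h : (Fin d → ℝ) → (Fin m → ℝ)}
    (hadm : admissibleH Γ blk Y h)
    {W : Matrix (Fin w) (Fin m) ℝ} (hW : isSolvabilityMatrix A blk W)
    {Q : Matrix (Fin (n + p)) (Fin q) ℝ} (hQ : isKernelMatrix A blk Q)
    {G : Matrix (Fin (n + p)) (Fin m) ℝ} (hG : isGenInv A blk G)
    (Z : Matrix (Fin c) (Fin n) ℝ)
    {κ : Fin m → ℝ} (hκ : κ ∈ posOrth m) (K : Fin c → ℝ) :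
    Set.BijOn (Fmap G Q h κ)
        {z ∈ Y ×ˢ posOrth q |
          powVec W (h z.1) = powVec W κ ∧ Z.mulVec (Fmap G Q h κ z) = K}
        (Eset Γ A κ ∩ {x | Z.mulVec x = K}) := by
  have key : ∀ α μ, α ∈ Y → μ ∈ posOrth q → powVec W (h α) = powVec W κ →
      κ * powVec (mR A) (Fmap G Q h κ (α, μ)) = fluxParam blk h (fun i => Real.exp
        (- (G.mulVec (fun j => Real.log (h α j / κ j)) + Q.mulVec (fun j => Real.log (μ j)))
          (Fin.natAdd n i))) α := by
    intro α μ hα hμ hw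
    have hp := (admissible_pos hadm hα).2
    rw [flux_iff hκ hp (Fmap_pos G Q h hκ hp hμ) _
      (fun i => (log_Fmap G Q h hκ hp hμ i).symm)]
    exact lift_eq hW hQ hG _ ((powVec_W_iff W hκ hp).1 hw) _
  refine ⟨?_, ?_, ?_⟩
  · rintro ⟨α, μ⟩ ⟨⟨hα, hμ⟩, hw, hz⟩
    have hp := (admissible_pos hadm hα).2
    refine ⟨⟨Fmap_pos G Q h hκ hp hμ, ?_⟩, hz⟩
    unfold massAction
    rw [key α μ hα hμ hw]
    obtain ⟨-, -, -, -, -, -, h7, -, -⟩ := hadm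
    exact (h7 _ α (fun i => Real.exp_pos _) hα).1
  · rintro ⟨α, μ⟩ ⟨⟨hα, hμ⟩, hw, hz⟩ ⟨α', μ'⟩ ⟨⟨hα', hμ'⟩, hw', hz'⟩ heq
    simp only at hα hμ hw hα' hμ' hw'
    have k1 := key α μ hα hμ hw
    have k2 := key α' μ' hα' hμ' hw'
    have hp := (admissible_pos hadm hα).2
    rw [heq, k2] at k1
    have h9 := hadm.2.2.2.2.2.2.2.2 _ _ α' α (fun i => Real.exp_pos _) (fun i => Real.exp_pos _) hα' hα k1
    obtain rfl := h9.2
    have hb := top_inj hblk hQ ((fun j => Real.log (μ j)) - fun j => Real.log (μ' j)) (by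
      intro i
      have l1 := log_Fmap G Q h hκ hp hμ i
      have l2 := log_Fmap G Q h hκ hp hμ' i
      rw [heq, l2] at l1
      rw [Matrix.mulVec_sub]
      simp only [Pi.add_apply, Pi.sub_apply] at l1 ⊢
      linarith)
    have : μ = μ' := by
      ext j
      have := congrFun hb j
      simp only [Pi.sub_apply, Pi.zero_apply, sub_eq_zero] at this
      exact Real.log_injOn_pos (hμ j) (hμ' j) this
    rw [this]
  · rintro x ⟨⟨hx, hg⟩, hz⟩
    obtain ⟨lam, α, hlam, hα, hv⟩ := hadm.2.2.2.2.2.2.2.1 (κ * powVec (mR A) x) hg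
      (fun j => mul_pos (hκ j) (powVec_pos _ hx j))
    have hp := (admissible_pos hadm hα).2
    have e := (flux_iff (A := A) (blk := blk) (h := h) hκ hp hx
      (Fin.append (fun i => Real.log (x i)) (fun i => - Real.log (lam i))) (by simp)).1 (by
        rw [hv]; congr 1; ext i; simp [Real.exp_log (hlam i)])
    obtain ⟨w0, b, hb⟩ := lift_exists hW hQ hG _ _ e
    have hμ : ∀ j, 0 < Real.exp (b j) := fun j => Real.exp_pos _
    have hF : Fmap G Q h κ (α, fun j => Real.exp (b j)) = x := by
      ext i
      apply Real.log_injOn_pos (Fmap_pos G Q h hκ hp hμ i) (hx i)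
      rw [log_Fmap G Q h hκ hp hμ i]
      simp only [Real.log_exp]
      rw [← hb]
      simp
    exact ⟨(α, fun j => Real.exp (b j)), ⟨⟨hα, hμ⟩, (powVec_W_iff W hκ hp).2 w0, by rw [hF]; exact hz⟩, hF⟩

end work2
section work3

lemma Fmap_hasFDerivAt {n m p d q : ℕ} (G : Matrix (Fin (n + p)) (Fin m) ℝ)
    (Q : Matrix (Fin (n + p)) (Fin q) ℝ) (h : (Fin d → ℝ) → (Fin m → ℝ))
    (L : (Fin d → ℝ) →ₗ[ℝ] (Fin m → ℝ)) (c : Fin m → ℝ) (hL : ∀ α, h α = L α + c)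
    {κ : Fin m → ℝ}
    (hκ : ∀ j, 0 < κ j) {α : Fin d → ℝ} {μ : Fin q → ℝ} (hα : ∀ j, 0 < h α j)
    (hμ : ∀ j, 0 < μ j) :
    ∃ D : (Fin d → ℝ) × (Fin q → ℝ) →L[ℝ] (Fin n → ℝ),
      HasFDerivAt (Fmap G Q h κ) D (α, μ) ∧
      ∀ v i, D v i = Fmap G Q h κ (α, μ) i *
        (G.mulVec (fun j => L v.1 j / h α j) + Q.mulVec (fun j => v.2 j / μ j))
          (Fin.castAdd p i) := by
  have hh : HasFDerivAt h (LinearMap.toContinuousLinearMap L) α := by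
    have : h = fun α => LinearMap.toContinuousLinearMap L α + c := by
      ext1 α; rw [hL]; rfl
    rw [this]
    exact (LinearMap.toContinuousLinearMap L).hasFDerivAt.add_const c
  have hh1 : HasFDerivAt (fun z : (Fin d → ℝ) × (Fin q → ℝ) => h z.1)
      ((LinearMap.toContinuousLinearMap L).comp (ContinuousLinearMap.fst ℝ _ _)) (α, μ) :=
    HasFDerivAt.comp (α, μ) (f := Prod.fst) (g := h) hh hasFDerivAt_fst
  have hh2 : HasFDerivAt (fun z : (Fin d → ℝ) × (Fin q → ℝ) => h z.1 / κ)
      (ContinuousLinearMap.pi fun j => (κ j)⁻¹ • (ContinuousLinearMap.proj j).comp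
        ((LinearMap.toContinuousLinearMap L).comp (ContinuousLinearMap.fst ℝ _ _))) (α, μ) := by
    rw [hasFDerivAt_pi]
    intro j
    simp only [Pi.div_apply, div_eq_mul_inv]
    exact (hasFDerivAt_pi'.1 hh1 j).mul_const _
  have hα' : ∀ j, 0 < (h α / κ) j := fun j => div_pos (hα j) (hκ j)
  have d1 := HasFDerivAt.comp (α, μ) (f := fun z : (Fin d → ℝ) × (Fin q → ℝ) => h z.1 / κ)
    (powVec_hasFDerivAt (topRows n p G) hα') hh2
  have d2 := HasFDerivAt.comp (α, μ) (f := fun z : (Fin d → ℝ) × (Fin q → ℝ) => z.2)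
    (powVec_hasFDerivAt (topRows n p Q) hμ) hasFDerivAt_snd
  refine ⟨_, hasFDerivAt_pi.2 fun i => (hasFDerivAt_pi'.1 d1 i).mul (hasFDerivAt_pi'.1 d2 i), ?_⟩
  intro v i
  have e1 : ∀ j, ((h α / κ) j)⁻¹ * ((κ j)⁻¹ * L v.1 j) = L v.1 j / h α j := by
    intro j
    have := (hκ j).ne'
    have := (hα j).ne'
    simp only [Pi.div_apply]
    field_simp
  have e2 : ∀ j, (μ j)⁻¹ * v.2 j = v.2 j / μ j := fun j => by rw [div_eq_mul_inv, mul_comm]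
  simp only [ContinuousLinearMap.pi_apply, ContinuousLinearMap.add_apply,
    ContinuousLinearMap.smul_apply, ContinuousLinearMap.comp_apply, ContinuousLinearMap.proj_apply,
    ContinuousLinearMap.sum_apply, smul_eq_mul, ContinuousLinearMap.coe_fst',
    ContinuousLinearMap.coe_snd', LinearMap.coe_toContinuousLinearMap', e1, e2, Function.comp,
    Fmap, Pi.mul_apply, Pi.add_apply, Matrix.mulVec, dotProduct, topRows, Matrix.of_apply]
  ring

lemma powW_hasFDerivAt {m d q w : ℕ} (W : Matrix (Fin w) (Fin m) ℝ) (h : (Fin d → ℝ) → (Fin m → ℝ))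
    (L : (Fin d → ℝ) →ₗ[ℝ] (Fin m → ℝ)) (c : Fin m → ℝ) (hL : ∀ α, h α = L α + c)
    {α : Fin d → ℝ} (μ : Fin q → ℝ) (hα : ∀ j, 0 < h α j) :
    ∃ D : (Fin d → ℝ) × (Fin q → ℝ) →L[ℝ] (Fin w → ℝ),
      HasFDerivAt (fun z : (Fin d → ℝ) × (Fin q → ℝ) => powVec W (h z.1)) D (α, μ) ∧
      ∀ v i, D v i = powVec W (h α) i * W.mulVec (fun j => L v.1 j / h α j) i := by
  have hh : HasFDerivAt h (LinearMap.toContinuousLinearMap L) α := by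
    have : h = fun α => LinearMap.toContinuousLinearMap L α + c := by
      ext1 α; rw [hL]; rfl
    rw [this]
    exact (LinearMap.toContinuousLinearMap L).hasFDerivAt.add_const c
  have hh1 : HasFDerivAt (fun z : (Fin d → ℝ) × (Fin q → ℝ) => h z.1)
      ((LinearMap.toContinuousLinearMap L).comp (ContinuousLinearMap.fst ℝ _ _)) (α, μ) :=
    HasFDerivAt.comp (α, μ) (f := Prod.fst) (g := h) hh hasFDerivAt_fst
  refine ⟨_, HasFDerivAt.comp (α, μ) (f := fun z : (Fin d → ℝ) × (Fin q → ℝ) => h z.1)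
    (powVec_hasFDerivAt W hα) hh1, ?_⟩
  intro v i
  have e2 : ∀ j, (h α j)⁻¹ * L v.1 j = L v.1 j / h α j := fun j => by rw [div_eq_mul_inv, mul_comm]
  simp only [ContinuousLinearMap.pi_apply, 
    ContinuousLinearMap.smul_apply, ContinuousLinearMap.comp_apply, ContinuousLinearMap.proj_apply,
    ContinuousLinearMap.sum_apply, smul_eq_mul, ContinuousLinearMap.coe_fst',
    LinearMap.coe_toContinuousLinearMap', e2,
    Matrix.mulVec, dotProduct]

lemma small_pos {m : ℕ} (f g : Fin m → ℝ) (hf : ∀ j, 0 < f j) :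
    ∀ᶠ t : ℝ in nhds 0, ∀ j, 0 < f j + t * g j := by
  rw [Filter.eventually_all]
  intro j
  have : ContinuousAt (fun t : ℝ => f j + t * g j) 0 := by fun_prop
  exact this.eventually (lt_mem_nhds (by simpa using hf j))

lemma small_Y {d : ℕ} {Y : Set (Fin d → ℝ)} (hY : IsOpen Y) {α : Fin d → ℝ} (hα : α ∈ Y)
    (a : Fin d → ℝ) : ∀ᶠ t : ℝ in nhds 0, α + t • a ∈ Y := by
  have : ContinuousAt (fun t : ℝ => α + t • a) 0 := by fun_prop
  exact this.eventually (hY.mem_nhds (by simpa using hα))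

lemma get_pos {P : ℝ → Prop} (h : ∀ᶠ t : ℝ in nhds 0, P t) : ∃ t, 0 < t ∧ P t := by
  have h1 : ∀ᶠ t : ℝ in nhdsWithin 0 (Set.Ioi 0), P t := h.filter_mono nhdsWithin_le_nhds
  obtain ⟨t, h2, h3⟩ := (h1.and self_mem_nhdsWithin).exists
  exact ⟨t, h3, h2⟩

lemma L_ker {n m p d : ℕ} {Γ : Matrix (Fin n) (Fin m) ℤ} {blk : Fin m → Fin p}
    {Y : Set (Fin d → ℝ)} {h : (Fin d → ℝ) → (Fin m → ℝ)} (hadm : admissibleH Γ blk Y h)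
    {L : (Fin d → ℝ) →ₗ[ℝ] (Fin m → ℝ)} {c : Fin m → ℝ} (hL : ∀ α, h α = L α + c)
    {α : Fin d → ℝ} (hα : α ∈ Y) (a : Fin d → ℝ) : (mR Γ).mulVec (L a) = 0 := by
  obtain ⟨t, ht, hY⟩ := get_pos (small_Y hadm.1 hα a)
  have e1 := (admissible_pos hadm hα).1
  have e2 := (admissible_pos hadm hY).1
  have e3 : h (α + t • a) = h α + t • L a := by
    rw [hL, hL, map_add, map_smul]; abel
  rw [e3, Matrix.mulVec_add, e1, Matrix.mulVec_smul, zero_add] at e2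
  exact (smul_eq_zero.1 e2).resolve_left ht.ne'

lemma L_inj {n m p d : ℕ} {Γ : Matrix (Fin n) (Fin m) ℤ} {blk : Fin m → Fin p}
    {Y : Set (Fin d → ℝ)} {h : (Fin d → ℝ) → (Fin m → ℝ)} (hadm : admissibleH Γ blk Y h)
    {L : (Fin d → ℝ) →ₗ[ℝ] (Fin m → ℝ)} {c : Fin m → ℝ} (hL : ∀ α, h α = L α + c)
    {α : Fin d → ℝ} (hα : α ∈ Y) (a : Fin d → ℝ) (y : Fin p → ℝ)
    (he : ∀ j, L a j = y (blk j) * h α j) : a = 0 := by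
  obtain ⟨t, ht, hY, hp⟩ := get_pos ((small_Y hadm.1 hα a).and
    (small_pos (fun _ : Fin p => (1 : ℝ)) y (by simp)))
  have e3 : h (α + t • a) = h α + t • L a := by
    rw [hL, hL, map_add, map_smul]; abel
  have := (hadm.2.2.2.2.2.2.2.2 1 (fun i => 1 + t * y i) (α + t • a) α (by simp) hp hY hα (by
    ext j
    simp only [fluxParam, e3, Pi.one_apply, Pi.add_apply, Pi.smul_apply, smul_eq_mul, he]
    ring)).2
  have h2 : t • a = 0 := by simpa using this
  exact (smul_eq_zero.1 h2).resolve_left ht.ne'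

lemma L_surj {n m p d : ℕ} {Γ : Matrix (Fin n) (Fin m) ℤ} {blk : Fin m → Fin p}
    {Y : Set (Fin d → ℝ)} {h : (Fin d → ℝ) → (Fin m → ℝ)} (hadm : admissibleH Γ blk Y h)
    {L : (Fin d → ℝ) →ₗ[ℝ] (Fin m → ℝ)} {c : Fin m → ℝ} (hL : ∀ α, h α = L α + c)
    {α : Fin d → ℝ} (hα : α ∈ Y) (v : Fin m → ℝ) (hv : (mR Γ).mulVec v = 0) :
    ∃ (a : Fin d → ℝ) (y : Fin p → ℝ), ∀ j, v j = L a j - y (blk j) * h α j := by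
  obtain ⟨hk, hp⟩ := admissible_pos hadm hα
  obtain ⟨t, ht, hpos⟩ := get_pos (small_pos (h α) v hp)
  obtain ⟨lam, α', hlam, hα', e⟩ := hadm.2.2.2.2.2.2.2.1 (h α + t • v)
    (by rw [Matrix.mulVec_add, Matrix.mulVec_smul, hk, hv]; simp) hpos
  obtain ⟨bY, hbY⟩ := hadm.2.2.2.2.2.1
  refine ⟨t⁻¹ • fun s => lam (bY s) * (α' s - α s), fun i => - (t⁻¹ * (lam i - 1)), fun j => ?_⟩
  have e1 : L (fun s => lam (bY s) * (α' s - α s)) j = lam (blk j) * (h α' j - h α j) := by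
    have := hbY (fun s => lam (bY s) * (α' s - α s)) (lam (blk j) • (α' - α)) j
      (by intro s hs; simp [hs])
    rw [hL, hL, map_smul, map_sub] at this
    rw [hL, hL]
    simp only [Pi.add_apply, Pi.smul_apply, Pi.sub_apply, smul_eq_mul] at this ⊢
    linarith
  have e2 := congrFun e j
  simp only [fluxParam, Pi.add_apply, Pi.smul_apply, smul_eq_mul] at e2
  rw [map_smul, Pi.smul_apply, e1, smul_eq_mul]
  field_simp
  linarith

end work3
section work4

lemma jac_mulVec {n m : ℕ} (Γ : Matrix (Fin n) (Fin m) ℤ) (A : Matrix (Fin m) (Fin n) ℤ)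
    (κ : Fin m → ℝ) (x z : Fin n → ℝ) :
    (jacMat Γ A κ x).mulVec z = (mR Γ).mulVec
      (fun j => (κ * powVec (mR A) x) j * (mR A).mulVec (fun i => z i / x i) j) := by
  unfold jacMat
  rw [← Matrix.mulVec_mulVec, ← Matrix.mulVec_mulVec, ← Matrix.mulVec_mulVec]
  have e1 : (Matrix.diagonal (fun i => (x i)⁻¹)).mulVec z = fun i => z i / x i := by
    ext i
    rw [Matrix.mulVec_diagonal, div_eq_mul_inv, mul_comm]
  rw [e1]
  congr 1
  ext j
  rw [Matrix.mulVec_diagonal]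

lemma part_two {n m p d w q c : ℕ}
    {Γ : Matrix (Fin n) (Fin m) ℤ} {A : Matrix (Fin m) (Fin n) ℤ}
    {blk : Fin m → Fin p} (hblk : Function.Surjective blk) (hfac : factorsOver Γ blk)
    {Y : Set (Fin d → ℝ)} {h : (Fin d → ℝ) → (Fin m → ℝ)}
    (hadm : admissibleH Γ blk Y h)
    {W : Matrix (Fin w) (Fin m) ℝ} (hW : isSolvabilityMatrix A blk W)
    {Q : Matrix (Fin (n + p)) (Fin q) ℝ} (hQ : isKernelMatrix A blk Q)
    {G : Matrix (Fin (n + p)) (Fin m) ℝ} (hG : isGenInv A blk G)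
    (Z : Matrix (Fin c) (Fin n) ℝ) (hc : c + (mR Γ).rank = n)
    (hZ : Z * mR Γ = 0) (hZrank : Z.rank = c)
    {κ : Fin m → ℝ} (hκ : κ ∈ posOrth m)
    {α : Fin d → ℝ} {μ : Fin q → ℝ} (hαA : α ∈ Aset W Y h κ) (hμ : μ ∈ posOrth q) :
      Set.BijOn (fun v => fderiv ℝ (Fmap G Q h κ) (α, μ) v)
        {v : (Fin d → ℝ) × (Fin q → ℝ) |
          fderiv ℝ (fun z : (Fin d → ℝ) × (Fin q → ℝ) =>
            (powVec W (h z.1) - powVec W κ,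
             Z.mulVec (Fmap G Q h κ z) - Z.mulVec (Fmap G Q h κ (α, μ)))) (α, μ) v = 0}
        ({z : Fin n → ℝ | (jacMat Γ A κ (Fmap G Q h κ (α, μ))).mulVec z = 0} ∩
          {z : Fin n → ℝ | ∃ v, (mR Γ).mulVec v = z}) := by
  obtain ⟨hα, hw⟩ := hαA
  obtain ⟨hker, hp⟩ := admissible_pos hadm hα
  obtain ⟨L, c0, hL⟩ := hadm.2.2.2.2.1
  obtain ⟨D, hD, hDv⟩ := Fmap_hasFDerivAt G Q h L c0 hL hκ hp hμ
  obtain ⟨D', hD', hDv'⟩ := powW_hasFDerivAt W h L c0 hL μ hp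
  -- the derivative of `H`
  have hZF : HasFDerivAt (fun z => Z.mulVec (Fmap G Q h κ z))
      ((LinearMap.toContinuousLinearMap Z.mulVecLin).comp D) (α, μ) :=
    HasFDerivAt.comp (α, μ) (f := Fmap G Q h κ)
      (LinearMap.toContinuousLinearMap Z.mulVecLin).hasFDerivAt hD
  have hH := (hD'.sub_const (powVec W κ)).prodMk (hZF.sub_const (Z.mulVec (Fmap G Q h κ (α, μ))))
  rw [hD.fderiv, hH.fderiv]
  have hkerH : ∀ v : (Fin d → ℝ) × (Fin q → ℝ),
      (D'.prod ((LinearMap.toContinuousLinearMap Z.mulVecLin).comp D)) v = 0 ↔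
      W.mulVec (fun j => L v.1 j / h α j) = 0 ∧ Z.mulVec (D v) = 0 := by
    intro v
    rw [ContinuousLinearMap.prod_apply, Prod.mk_eq_zero]
    refine and_congr ?_ Iff.rfl
    rw [funext_iff, funext_iff]
    refine forall_congr' fun i => ?_
    rw [hDv']
    simp [(powVec_pos W hp i).ne']
  have hZim : ∀ z, Z.mulVec z = 0 ↔ ∃ v, (mR Γ).mulVec v = z := by
    intro z
    constructor
    · exact exists_of_rank Z (mR Γ) hZ (by rw [hZrank]; exact hc) z
    · rintro ⟨v, rfl⟩
      rw [Matrix.mulVec_mulVec, hZ, Matrix.zero_mulVec]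
  have hx := Fmap_pos G Q h hκ hp hμ
  have hflux := (flux_iff (A := A) (blk := blk) hκ hp hx _
      (fun i => (log_Fmap G Q h hκ hp hμ i).symm)).2
      (lift_eq hW hQ hG _ ((powVec_W_iff W hκ hp).1 hw) _)
  generalize Fmap G Q h κ (α, μ) = x at *
  have hlam0 : ∃ lam : Fin p → ℝ, (∀ i, 0 < lam i) ∧
      κ * powVec (mR A) x = fluxParam blk h lam α := ⟨_, fun i => Real.exp_pos _, hflux⟩
  clear hflux
  obtain ⟨lam, hlam, hflux⟩ := hlam0
  have hdiv : ∀ v, (fun i => D v i / x i) = fun i =>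
      (G.mulVec (fun j => L v.1 j / h α j) + Q.mulVec (fun j => v.2 j / μ j))
        (Fin.castAdd p i) := by
    intro v
    ext i
    rw [hDv, mul_div_assoc, mul_comm, div_mul_cancel₀ _ (hx i).ne']
  -- the equation `A (z/x) = u - 1_P y`
  have hAz : ∀ v : (Fin d → ℝ) × (Fin q → ℝ), W.mulVec (fun j => L v.1 j / h α j) = 0 →
      ∀ j, (mR A).mulVec (fun i => D v i / x i) j + (G.mulVec (fun j => L v.1 j / h α j)
        + Q.mulVec (fun j => v.2 j / μ j)) (Fin.natAdd n (blk j)) = L v.1 j / h α j := by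
    intro v hv j
    have := congrFun (lift_eq hW hQ hG _ hv (fun j => v.2 j / μ j)) j
    rw [srcMat_mulVec] at this
    rw [hdiv]
    exact this
  refine ⟨?_, ?_, ?_⟩
  · intro v hv
    obtain ⟨h1, h2⟩ := (hkerH v).1 hv
    refine ⟨?_, (hZim _).1 h2⟩
    show (jacMat Γ A κ x).mulVec (D v) = 0
    rw [jac_mulVec]
    have h3 := hAz v h1
    generalize (G.mulVec (fun j => L v.1 j / h α j) + Q.mulVec (fun j => v.2 j / μ j)) = ξ at h3
    have e : (fun j => (κ * powVec (mR A) x) j * (mR A).mulVec (fun i => D v i / x i) j)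
        = (fun j => lam (blk j) * L v.1 j) -
          fun j => (fun i => lam i * ξ (Fin.natAdd n i)) (blk j) * h α j := by
      ext j
      rw [hflux, eq_sub_of_add_eq (h3 j)]
      have := (hp j).ne'
      simp only [fluxParam, Pi.sub_apply]
      field_simp
    rw [e, Matrix.mulVec_sub, scale_ker hfac _ (L_ker hadm hL hα v.1),
      scale_ker hfac _ hker (fun i => lam i * ξ (Fin.natAdd n i)),
      sub_zero]
  · have hinj0 : ∀ v : (Fin d → ℝ) × (Fin q → ℝ), W.mulVec (fun j => L v.1 j / h α j) = 0 →
        D v = 0 → v = 0 := by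
      intro v h1 h2
      have h3 := hAz v h1
      have e0 : (fun i => D v i / x i) = 0 := by ext i; simp [h2]
      have h4 := hdiv v
      have ha : v.1 = 0 := by
        apply L_inj hadm hL hα v.1 (fun i => (G.mulVec (fun j => L v.1 j / h α j)
          + Q.mulVec (fun j => v.2 j / μ j)) (Fin.natAdd n i))
        intro j
        have h5 := h3 j
        rw [e0, Matrix.mulVec_zero, Pi.zero_apply, zero_add] at h5
        show L v.1 j = (G.mulVec (fun j => L v.1 j / h α j)
          + Q.mulVec (fun j => v.2 j / μ j)) (Fin.natAdd n (blk j)) * h α j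
        rw [h5, div_mul_cancel₀ _ (hp j).ne']
      have hb := top_inj hblk hQ (fun j => v.2 j / μ j) (by
        intro i
        have h6 := congrFun (e0.symm.trans h4) i
        rw [ha] at h6
        have e1 : (fun j => L 0 j / h α j) = (0 : Fin m → ℝ) := by ext j; simp
        rw [e1, Matrix.mulVec_zero, zero_add] at h6
        exact h6.symm)
      refine Prod.ext ha ?_
      ext j
      have := congrFun hb j
      simp only [Pi.zero_apply, div_eq_zero_iff] at this
      exact this.resolve_right (hμ j).ne'
    intro v hv v' hv' heq
    have hs : (D'.prod ((LinearMap.toContinuousLinearMap Z.mulVecLin).comp D)) (v - v') = 0 := by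
      rw [map_sub, hv, hv', sub_zero]
    have := hinj0 (v - v') ((hkerH _).1 hs).1 (by rw [map_sub]; exact sub_eq_zero.2 heq)
    exact sub_eq_zero.1 this
  · rintro z ⟨hz, hzim⟩
    change (jacMat Γ A κ x).mulVec z = 0 at hz
    rw [jac_mulVec] at hz
    have hz2 := scale_ker hfac _ hz (fun i => (lam i)⁻¹)
    obtain ⟨a, y, hay⟩ := L_surj hadm hL hα _ hz2
    have hsrc : (srcMat A blk).mulVec (Fin.append (fun i => z i / x i) y)
        = fun j => L a j / h α j := by
      ext j
      rw [srcMat_mulVec]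
      simp only [Fin.append_left, Fin.append_right]
      have h5 := hay j
      rw [hflux] at h5
      simp only [fluxParam] at h5
      have := (hp j).ne'
      have := (hlam (blk j)).ne'
      field_simp at h5 ⊢
      linarith
    obtain ⟨h1, b, hb⟩ := lift_exists hW hQ hG _ _ hsrc
    have hbμ : (fun j => (μ j * b j) / μ j) = b := by
      ext j
      rw [mul_comm, mul_div_assoc, div_self (hμ j).ne', mul_one]
    have hDz : D (a, fun j => μ j * b j) = z := by
      ext i
      rw [hDv]
      simp only [hbμ]
      rw [← hb, Fin.append_left, mul_comm, div_mul_cancel₀ _ (hx i).ne']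
    exact ⟨(a, fun j => μ j * b j), (hkerH _).2 ⟨h1, by rw [hDz]; exact (hZim z).2 hzim⟩, hDz⟩

end work4

/-- Theorem on positive equilibria in stoichiometric classes:
with `H_{κ,K}(α,μ) = (h(α)^W − κ^W, Z F_κ(α,μ) − K)`:
(i) `F_κ` restricts to a bijection from the zero set of `H_{κ,K}` in `Y × ℝ^{n-s_P}_+`
onto `E_κ ∩ S_K`; (ii) for `(α,μ) ∈ A_κ × ℝ^{n-s_P}_+`, `x := F_κ(α,μ)`, `K := Zx`,
the Jacobian `J_{F_κ}(α,μ)` maps `ker J_{H_{κ,K}}(α,μ)` isomorphically onto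
`ker J_{g_κ}(x) ∩ im Γ`; consequently `x` is nondegenerate iff `(α,μ)` is a
nondegenerate zero of `H_{κ,K}`. -/
theorem statement2 {n m p d w q c : ℕ}
    (Γ : Matrix (Fin n) (Fin m) ℤ) (A : Matrix (Fin m) (Fin n) ℤ)
    (hA : ∀ i j, 0 ≤ A i j)
    (blk : Fin m → Fin p) (hblk : Function.Surjective blk)
    (hdyn : dynNontrivial Γ) (hfac : factorsOver Γ blk)
    (Y : Set (Fin d → ℝ)) (h : (Fin d → ℝ) → (Fin m → ℝ))
    (hd : m = d + (mR Γ).rank + p)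
    (hadm : admissibleH Γ blk Y h)
    (W : Matrix (Fin w) (Fin m) ℝ) (hW : isSolvabilityMatrix A blk W)
    (Q : Matrix (Fin (n + p)) (Fin q) ℝ) (hQ : isKernelMatrix A blk Q)
    (G : Matrix (Fin (n + p)) (Fin m) ℝ) (hG : isGenInv A blk G)
    (Z : Matrix (Fin c) (Fin n) ℝ) (hc : c + (mR Γ).rank = n)
    (hZ : Z * mR Γ = 0) (hZrank : Z.rank = c)
    (κ : Fin m → ℝ) (hκ : κ ∈ posOrth m) :
    (∀ K : Fin c → ℝ,
      Set.BijOn (Fmap G Q h κ)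
        {z ∈ Y ×ˢ posOrth q |
          powVec W (h z.1) = powVec W κ ∧ Z.mulVec (Fmap G Q h κ z) = K}
        (Eset Γ A κ ∩ {x | Z.mulVec x = K})) ∧
    (∀ (α : Fin d → ℝ) (μ : Fin q → ℝ), α ∈ Aset W Y h κ → μ ∈ posOrth q →
      Set.BijOn (fun v => fderiv ℝ (Fmap G Q h κ) (α, μ) v)
        {v : (Fin d → ℝ) × (Fin q → ℝ) |
          fderiv ℝ (fun z : (Fin d → ℝ) × (Fin q → ℝ) =>
            (powVec W (h z.1) - powVec W κ,
             Z.mulVec (Fmap G Q h κ z) - Z.mulVec (Fmap G Q h κ (α, μ)))) (α, μ) v = 0}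
        ({z : Fin n → ℝ | (jacMat Γ A κ (Fmap G Q h κ (α, μ))).mulVec z = 0} ∩
          {z : Fin n → ℝ | ∃ v, (mR Γ).mulVec v = z}) ∧
      (nondegAt Γ A κ (Fmap G Q h κ (α, μ)) ↔
        ∀ v : (Fin d → ℝ) × (Fin q → ℝ),
          fderiv ℝ (fun z : (Fin d → ℝ) × (Fin q → ℝ) =>
            (powVec W (h z.1) - powVec W κ,
             Z.mulVec (Fmap G Q h κ z) - Z.mulVec (Fmap G Q h κ (α, μ)))) (α, μ) v = 0 →
          v = 0)) := by
  refine ⟨fun K => part_one hblk hadm hW hQ hG Z hκ K, fun α μ hα hμ => ?_⟩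
  have hb := part_two hblk hfac hadm hW hQ hG Z hc hZ hZrank hκ hα hμ
  refine ⟨hb, ?_, ?_⟩
  · intro hn v hv
    have hm := hb.mapsTo hv
    have h0 := hn _ hm.1 hm.2
    refine hb.injOn hv ?_ ?_
    · exact map_zero _
    · simp only [map_zero]
      exact h0
  · intro hn z hz hzim
    obtain ⟨v, hv, rfl⟩ := hb.surjOn ⟨hz, hzim⟩
    rw [hn v hv]
    exact map_zero _

end
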